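/- If U is a semisimple Banach algebra, then every derivation D : A ×_θ U → U is automatically continuous. -/

import Mathlib

open Filter Topology

/-- The Lau product multiplication on A × U:
(a,u)(a',u') = (aa', θ(a)u' + θ(a')u + uu'). -/
def lauMul {A U : Type*} [Mul A] [Mul U] [Add U] [SMul ℂ U]
    (θ : A → ℂ) (p q : A × U) : A × U :=
  (p.1 * q.1, θ p.1 • q.2 + θ q.1 • p.2 + p.2 * q.2)

/-- In a semisimple ring, only zero lies in every maximal left ideal. -/
theorem eq_zero_of_forall_mem_maximal {U : Type*} [Ring U]
    (hss : ∀ u : U, (∀ v : U, IsUnit (1 - v * u)) → u = 0)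
    {u : U} (hu : ∀ M : Ideal U, M.IsMaximal → u ∈ M) : u = 0 := by
  have hleft : ∀ v : U, ∃ z, z * (1 - v * u) = 1 := by
    intro v
    have hmem : u ∈ Ideal.jacobson (⊥ : Ideal U) := by
      rw [Ideal.jacobson, Ideal.mem_sInf]
      exact fun {M} hM => hu M hM.2
    obtain ⟨z, hz⟩ := Ideal.mem_jacobson_iff.1 hmem (-v)
    rw [Submodule.mem_bot] at hz
    refine ⟨z, ?_⟩
    rw [← sub_eq_zero, ← hz]
    noncomm_ring
  refine hss u fun v => ?_
  obtain ⟨z, hz⟩ := hleft v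
  obtain ⟨y, hy⟩ := hleft (-(z * v))
  have hz' : 1 - -(z * v) * u = z := by
    have : z - z * v * u = 1 := by rw [← hz]; noncomm_ring
    rw [← this]; noncomm_ring
  rw [hz'] at hy
  have hyz : y = 1 - v * u := left_inv_eq_right_inv hy hz
  exact ⟨⟨1 - v * u, z, hyz ▸ hy, hz⟩, rfl⟩

/-- An element outside a maximal left ideal is left invertible modulo that ideal. -/
theorem exists_mul_sub_one_mem {U : Type*} [Ring U] {M : Ideal U} (hM : M.IsMaximal)
    {y : U} (hy : y ∉ M) : ∃ a, a * y - 1 ∈ M := by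
  have htop : M ⊔ Ideal.span {y} = ⊤ := hM.1.2 _ <| by
    refine lt_of_le_of_ne le_sup_left fun h => hy ?_
    rw [h]
    exact Ideal.mem_sup_right (Ideal.mem_span_singleton_self y)
  obtain ⟨m, hm, s, hs, hms⟩ := Submodule.mem_sup.1 ((Ideal.eq_top_iff_one _).1 htop)
  obtain ⟨a, rfl⟩ := Ideal.mem_span_singleton'.1 hs
  refine ⟨a, ?_⟩
  rw [← hms, sub_add_cancel_right]
  exact M.neg_mem hm

/-- Gelfand–Mazur for a corner `eUe` all of whose nonzero elements are right invertible. -/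
theorem corner_eq_smul {U : Type*} [NormedRing U] [NormedAlgebra ℂ U] [CompleteSpace U]
    {e : U} (he : e * e = e) (he0 : e ≠ 0)
    (hinv : ∀ u, e * u = u → u * e = u → u ≠ 0 → ∃ w, e * w = w ∧ w * e = w ∧ u * w = e)
    {u : U} (heu : e * u = u) (hue : u * e = u) : ∃ z : ℂ, u = z • e := by
  have htwo : ∀ u, e * u = u → u * e = u → u ≠ 0 →
      ∃ w, e * w = w ∧ w * e = w ∧ u * w = e ∧ w * u = e := by
    intro u h1 h2 h0
    obtain ⟨w, hw1, hw2, hw⟩ := hinv u h1 h2 h0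
    have hw0 : w ≠ 0 := by
      rintro rfl
      exact he0 (by rw [← hw, mul_zero])
    obtain ⟨x, hx1, hx2, hx⟩ := hinv w hw1 hw2 hw0
    have : x = u := by
      calc x = (u * w) * x := by rw [hw, hx1]
        _ = u := by rw [mul_assoc, hx, h2]
    exact ⟨w, hw1, hw2, hw, this ▸ hx⟩
  by_contra! hne
  have hspec : ∀ z ∈ spectrum ℂ u, z = 0 := by
    intro z hz
    by_contra hz0
    refine hz ?_
    obtain ⟨w, hw1, hw2, hw3, hw4⟩ := htwo (u - z • e)
      (by rw [mul_sub, mul_smul_comm, heu, he]) (by rw [sub_mul, smul_mul_assoc, hue, he])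
      (sub_ne_zero.2 (hne z))
    have hr : u * w = e + z • w := by
      rw [sub_mul, smul_mul_assoc, hw1] at hw3
      rw [← hw3, sub_add_cancel]
    have hl : w * u = e + z • w := by
      rw [mul_sub, mul_smul_comm, hw2] at hw4
      rw [← hw4, sub_add_cancel]
    refine ⟨⟨algebraMap ℂ U z - u, z⁻¹ • (1 - e) - w, ?_, ?_⟩, rfl⟩
    · simp only [Algebra.algebraMap_eq_smul_one, sub_mul, mul_sub, smul_mul_assoc, one_mul,
        mul_smul_comm, mul_one, hr, hue, smul_sub, smul_smul, inv_mul_cancel₀ hz0, one_smul]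
      abel
    · simp only [Algebra.algebraMap_eq_smul_one, sub_mul, mul_sub, smul_mul_assoc, one_mul,
        mul_smul_comm, mul_one, hl, heu, smul_sub, smul_smul, mul_inv_cancel₀ hz0, one_smul]
      abel
  have hrad : spectralRadius ℂ u = 0 := by
    rw [spectralRadius]
    refine le_antisymm (iSup₂_le fun z hz => ?_) bot_le
    simp [hspec z hz]
  obtain ⟨w, hw1, hw2, hw3, hw4⟩ := htwo u heu hue (by simpa using hne 0)
  have hpow : ∀ n : ℕ, u ^ (n + 1) * w ^ (n + 1) = e := by
    intro n
    induction n with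
    | zero => simpa using hw3
    | succ n ih =>
      have h1 : e * w ^ (n + 1) = w ^ (n + 1) := by rw [pow_succ', ← mul_assoc, hw1]
      rw [pow_succ u, pow_succ' w (n + 1), mul_assoc, ← mul_assoc u w, hw3, h1, ih]
  set K : ℝ := 2 * (‖w‖ + 1) with hK
  have hKpos : 0 < K := by positivity
  have hlim := spectrum.pow_norm_pow_one_div_tendsto_nhds_spectralRadius u
  rw [hrad] at hlim
  have hev : ∀ᶠ n : ℕ in atTop, ‖u ^ n‖ ≤ (K⁻¹) ^ n := by
    filter_upwards [hlim.eventually (gt_mem_nhds (ENNReal.ofReal_pos.2 (inv_pos.2 hKpos))),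
      eventually_gt_atTop 0] with n hn hn0
    have h1 := (ENNReal.ofReal_lt_ofReal_iff (inv_pos.2 hKpos)).1 hn
    calc ‖u ^ n‖ = (‖u ^ n‖ ^ (1 / n : ℝ)) ^ n := by
          rw [one_div, Real.rpow_inv_natCast_pow (norm_nonneg _) hn0.ne']
      _ ≤ _ := by gcongr
  have hbd : ∀ᶠ n : ℕ in atTop, ‖e‖ ≤ (1 / 2 : ℝ) ^ n := by
    filter_upwards [hev, eventually_gt_atTop 0] with n hn hn0
    obtain ⟨m, rfl⟩ := Nat.exists_eq_succ_of_ne_zero hn0.ne'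
    calc ‖e‖ = ‖u ^ (m + 1) * w ^ (m + 1)‖ := by rw [hpow]
      _ ≤ ‖u ^ (m + 1)‖ * ‖w ^ (m + 1)‖ := norm_mul_le _ _
      _ ≤ (K⁻¹) ^ (m + 1) * ‖w‖ ^ (m + 1) := by
          gcongr
          exact norm_pow_le' w m.succ_pos
      _ = (K⁻¹ * ‖w‖) ^ (m + 1) := (mul_pow _ _ _).symm
      _ ≤ (1 / 2 : ℝ) ^ (m + 1) := by
          gcongr
          rw [hK, inv_mul_le_iff₀ (by positivity)]
          linarith
  have h0 : ‖e‖ ≤ 0 := ge_of_tendsto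
    (tendsto_pow_atTop_nhds_zero_of_lt_one (by norm_num) (by norm_num)) hbd
  exact he0 (norm_le_zero_iff.1 h0)

/-- Gliding hump: linear maps `φ n` dominated by one function on `U` cannot all be unbounded on
`U * b n` and bounded on `U * b (n + 1)`, where `b (n + 1) = c n * b n`. -/
theorem false_of_gliding_hump {U : Type*} [NormedRing U] [NormedAlgebra ℂ U] [CompleteSpace U]
    {F : ℕ → Type*} [∀ n, NormedAddCommGroup (F n)] [∀ n, NormedSpace ℂ (F n)]
    (b c : ℕ → U) (hb : ∀ n, b (n + 1) = c n * b n) (hc : ∀ n, ‖c n‖ ≤ 1)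
    (φ : ∀ n, U →ₗ[ℂ] F n) (g : U → ℝ) (κ : ℕ → ℝ) (hφ : ∀ n a, ‖φ n a‖ ≤ κ n * g a)
    (C : ℕ → ℝ) (hC : ∀ n a, ‖φ n (a * b (n + 1))‖ ≤ C n * ‖a‖)
    (hunb : ∀ n K, ∃ a, K * ‖a‖ < ‖φ n (a * b n)‖) : False := by
  have hlarge : ∀ n, ∀ ε > 0, ∀ K : ℝ, ∃ a, ‖a‖ ≤ ε ∧ K ≤ ‖φ n (a * b n)‖ := by
    intro n ε hε K
    by_contra! h
    obtain ⟨C', hC'⟩ := LinearMap.bound_of_ball_bound hε K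
      ((φ n).comp (LinearMap.mulRight ℂ (b n)))
      fun z hz => by simpa using (h z (mem_ball_zero_iff.1 hz).le).le
    obtain ⟨a, ha⟩ := hunb n C'
    exact absurd (hC' a) (by simpa using ha)
  choose f hf1 hf2 using fun (n : ℕ) (s : U) => hlarge n ((1 / 2) ^ n) (by positivity)
    (|κ n| * n + ‖φ n s‖ + |C n| * (2 * ‖(1 : U)‖) + 1)
  let s : ℕ → U := fun n => Nat.rec 0 (fun n s => s + f n s * b n) n
  let a : ℕ → U := fun n => f n (s n)
  have hs : ∀ n, s n = ∑ k ∈ Finset.range n, a k * b k := by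
    intro n
    induction n with
    | zero => rfl
    | succ n ih => rw [Finset.sum_range_succ, ← ih]
  let d : ℕ → ℕ → U := fun n k => Nat.rec 1 (fun k x => c (n + k) * x) k
  have hd : ∀ n k, b (k + n) = d n k * b n := by
    intro n k
    induction k with
    | zero => simp [d]
    | succ k ih =>
      change _ = c (n + k) * d n k * b n
      rw [mul_assoc, ← ih, add_right_comm, hb, add_comm n k]
  have hdn : ∀ n k, ‖d n k‖ ≤ ‖(1 : U)‖ := by
    intro n k
    induction k with
    | zero => exact le_rfl
    | succ k ih =>
      calc ‖c (n + k) * d n k‖ ≤ ‖c (n + k)‖ * ‖d n k‖ := norm_mul_le _ _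
        _ ≤ 1 * ‖(1 : U)‖ := by gcongr; exact hc _
        _ = _ := one_mul _
  have hterm : ∀ n k, ‖a (k + n) * d n k‖ ≤ (1 / 2 : ℝ) ^ k * ‖(1 : U)‖ := by
    intro n k
    calc ‖a (k + n) * d n k‖ ≤ ‖a (k + n)‖ * ‖d n k‖ := norm_mul_le _ _
      _ ≤ (1 / 2 : ℝ) ^ (k + n) * ‖(1 : U)‖ := by
          gcongr
          · exact hf1 _ _
          · exact hdn _ _
      _ ≤ _ := by
          gcongr ?_ * _
          exact pow_le_pow_of_le_one (by norm_num) (by norm_num) (Nat.le_add_right _ _)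
  have hgeo : HasSum (fun k => (1 / 2 : ℝ) ^ k * ‖(1 : U)‖) (2 * ‖(1 : U)‖) :=
    hasSum_geometric_two.mul_right _
  have hsum : ∀ n, Summable fun k => a (k + n) * d n k := fun n =>
    Summable.of_norm_bounded hgeo.summable (hterm n)
  let r : ℕ → U := fun n => ∑' k, a (k + n) * d n k
  have hr : ∀ n, ‖r n‖ ≤ 2 * ‖(1 : U)‖ := fun n => tsum_of_norm_bounded hgeo (hterm n)
  have htail : ∀ n, (∑' k, a (k + n) * b (k + n)) = r n * b n := by
    intro n
    rw [← (hsum n).tsum_mul_right]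
    simp only [hd, mul_assoc]
  have hsum0 : Summable fun k => a k * b k := by
    have := (hsum 0).mul_right (b 0)
    refine this.congr fun k => ?_
    have := hd 0 k
    rw [add_zero] at this
    rw [this, add_zero, mul_assoc]
  set x := ∑' k, a k * b k with hx
  have hsplit : ∀ n, s n + a n * b n + r (n + 1) * b (n + 1) = x := by
    intro n
    rw [hx, ← hsum0.sum_add_tsum_nat_add (n + 1), htail, Finset.sum_range_succ, hs]
  have hcontr : ∀ n : ℕ, |κ n| * n + 1 ≤ κ n * g x := by
    intro n
    have h1 := hf2 n (s n)
    have h2 : ‖φ n (a n * b n)‖ ≤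
        ‖φ n x‖ + ‖φ n (s n)‖ + ‖φ n (r (n + 1) * b (n + 1))‖ := by
      have : φ n (a n * b n) = φ n x - φ n (s n) - φ n (r (n + 1) * b (n + 1)) := by
        rw [← map_sub, ← map_sub, ← hsplit n]
        congr 1
        abel
      rw [this]
      refine (norm_sub_le _ _).trans ?_
      gcongr
      exact norm_sub_le _ _
    have h3 : ‖φ n (r (n + 1) * b (n + 1))‖ ≤ |C n| * (2 * ‖(1 : U)‖) := by
      refine (hC n _).trans ?_
      gcongr
      · exact le_abs_self _
      · exact hr _
    have h4 := hφ n x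
    change _ ≤ ‖φ n (a n * b n)‖ at h1
    linarith
  obtain ⟨n, hn⟩ := exists_nat_ge |g x|
  have h1 := hcontr n
  have h2 : κ n * g x ≤ |κ n| * |g x| := by rw [← abs_mul]; exact le_abs_self _
  have h3 : |κ n| * |g x| ≤ |κ n| * n := by gcongr
  linarith

/-- The separating space of a map. -/
def separatingSpace {U : Type*} [TopologicalSpace U] [Zero U] (T : U → U) : Set U :=
  {s | ∃ a : ℕ → U, Tendsto a atTop (𝓝 0) ∧ Tendsto (fun n => T (a n)) atTop (𝓝 s)}

section Derivation

variable {U : Type*} [NormedRing U] [NormedAlgebra ℂ U] {T : U →ₗ[ℂ] U}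

theorem mul_mem_separatingSpace_left (hT : ∀ a b, T (a * b) = a * T b + T a * b)
    {s : U} (hs : s ∈ separatingSpace T) (v : U) : v * s ∈ separatingSpace T := by
  obtain ⟨a, ha, hTa⟩ := hs
  refine ⟨fun n => v * a n, by simpa using ha.const_mul v, ?_⟩
  simpa [hT] using (hTa.const_mul v).add (ha.const_mul (T v))

theorem mul_mem_separatingSpace_right (hT : ∀ a b, T (a * b) = a * T b + T a * b)
    {s : U} (hs : s ∈ separatingSpace T) (v : U) : s * v ∈ separatingSpace T := by
  obtain ⟨a, ha, hTa⟩ := hs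
  refine ⟨fun n => a n * v, by simpa using ha.mul_const v, ?_⟩
  simpa [hT] using (ha.mul_const (T v)).add (hTa.mul_const v)

/-- A minimal idempotent with one-dimensional corner cannot lie in the separating space. -/
theorem eq_zero_of_mem_separatingSpace (hT : ∀ a b, T (a * b) = a * T b + T a * b)
    {e : U} (he : e * e = e) (hcorner : ∀ v, ∃ z : ℂ, e * v * e = z • e)
    (hs : e ∈ separatingSpace T) : e = 0 := by
  by_contra he0
  obtain ⟨a, ha, hTa⟩ := hs
  choose z hz using fun n => hcorner (a n)
  have hcomp : Tendsto (fun n => e * a n * e) atTop (𝓝 0) := by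
    simpa using (ha.const_mul e).mul_const e
  have hz0 : Tendsto z atTop (𝓝 0) := by
    rw [tendsto_zero_iff_norm_tendsto_zero] at hcomp ⊢
    have := hcomp.div_const ‖e‖
    simpa [hz, norm_smul, norm_ne_zero_iff.2 he0] using this
  have h1 : Tendsto (fun n => T (e * a n * e)) atTop (𝓝 0) := by
    simpa [hz] using hz0.smul_const (T e)
  have h2 : Tendsto (fun n => T (e * a n * e)) atTop (𝓝 (e * e * e)) := by
    have := ((ha.const_mul e).mul_const (T e)).add
      (((hTa.const_mul e).add (ha.const_mul (T e))).mul_const e)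
    simpa [hT] using this
  have := tendsto_nhds_unique h2 h1
  rw [he, he] at this
  exact he0 this

variable [CompleteSpace U]

/-- If `b` lies in the separating space and all nonzero vectors in its range, over all simple
modules, have the same annihilator, then `b = 0`. -/
theorem eq_zero_of_unique_annihilator
    (hss : ∀ u : U, (∀ v : U, IsUnit (1 - v * u)) → u = 0)
    (hT : ∀ a b, T (a * b) = a * T b + T a * b) {b : U} (hb : b ∈ separatingSpace T)
    (huniq : ∀ (M M' : Ideal U), M.IsMaximal → M'.IsMaximal → ∀ x x', b * x ∉ M → b * x' ∉ M' →
      ∀ c, c * (b * x) ∈ M → c * (b * x') ∈ M') : b = 0 := by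
  by_contra hb0
  have hkey : ∀ y, b * y ≠ 0 → ∃ a, (b * y) * a * b = b := by
    intro y hy
    obtain ⟨M, hM, hyM⟩ : ∃ M : Ideal U, M.IsMaximal ∧ b * y ∉ M := by
      by_contra! h
      exact hy (eq_zero_of_forall_mem_maximal hss h)
    obtain ⟨a, ha⟩ := exists_mul_sub_one_mem hM hyM
    refine ⟨a, sub_eq_zero.1 (eq_zero_of_forall_mem_maximal hss fun M' hM' => ?_)⟩
    have h1 : ((b * y) * a - 1) * (b * y) ∈ M := by
      have : ((b * y) * a - 1) * (b * y) = (b * y) * (a * (b * y) - 1) := by noncomm_ring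
      rw [this]
      exact M.mul_mem_left _ ha
    have h2 : (b * y) * a * b - b = ((b * y) * a - 1) * (b * 1) := by noncomm_ring
    rw [h2]
    by_cases hbM : b * 1 ∈ M'
    · exact M'.mul_mem_left _ hbM
    · exact huniq M M' hM hM' y 1 hyM hbM _ h1
  obtain ⟨a, ha⟩ := hkey 1 (by rwa [mul_one])
  rw [mul_one] at ha
  have he : (b * a) * (b * a) = b * a := by rw [← mul_assoc, ha]
  have he0 : b * a ≠ 0 := fun h => hb0 (by rw [← ha, h, zero_mul])
  refine he0 (eq_zero_of_mem_separatingSpace hT he (fun v => ?_)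
    (mul_mem_separatingSpace_right hT hb a))
  refine corner_eq_smul he he0 ?_ (by simp only [← mul_assoc, ha])
    (by rw [mul_assoc, he])
  intro u h1 h2 h0
  have hu : u = b * (a * u) := by rw [← mul_assoc, h1]
  obtain ⟨w, hw⟩ := hkey (a * u) (hu ▸ h0)
  rw [← hu] at hw
  refine ⟨b * a * w * (b * a), by simp only [← mul_assoc, ha], by rw [mul_assoc, he], ?_⟩
  calc u * (b * a * w * (b * a)) = (u * (b * a)) * w * b * a := by noncomm_ring
    _ = b * a := by rw [h2, hw]

/-- A derivation composed with evaluation at a vector of a simple module is unbounded when the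
separating space does not annihilate the vector. -/
theorem not_bounded_of_mem_separatingSpace (hT : ∀ a b, T (a * b) = a * T b + T a * b)
    {M : Ideal U} (hM : M.IsMaximal) {b x s : U} (hs : s ∈ separatingSpace T)
    (hsM : s * (b * x) ∉ M) (K : ℝ) :
    ∃ a, K * ‖a‖ < ‖M.mkQ (T (a * b) * x)‖ := by
  by_contra! h
  obtain ⟨a, ha, hTa⟩ := hs
  have : IsClosed (M : Set U) := hM.isClosed
  have hcont : Continuous fun u : U => (M.mkQ u : U ⧸ M) := continuous_quot_mk
  have h1 : Tendsto (fun n => ‖M.mkQ (T (a n * b) * x)‖) atTop (𝓝 0) :=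
    squeeze_zero (fun _ => norm_nonneg _) (fun n => h (a n))
      (by simpa using ha.norm.const_mul K)
  have h2 : Tendsto (fun n => T (a n * b) * x) atTop (𝓝 (s * b * x)) := by
    simpa [hT] using ((ha.mul_const (T b)).add (hTa.mul_const b)).mul_const x
  have h3 := tendsto_nhds_unique ((hcont.tendsto _).comp h2).norm h1
  refine hsM ?_
  have h4 : M.mkQ (s * b * x) = 0 := by
    exact norm_eq_zero.1 h3
  rw [← mul_assoc]
  simpa using h4

/-- Johnson–Sinclair: derivations on semisimple Banach algebras are continuous. -/
theorem continuous_of_derivation_of_semisimple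
    (hss : ∀ u : U, (∀ v : U, IsUnit (1 - v * u)) → u = 0)
    (hT : ∀ a b, T (a * b) = a * T b + T a * b) : Continuous T := by
  suffices hsep : ∀ s ∈ separatingSpace T, s = 0 by
    refine T.continuous_of_seq_closed_graph fun u x y hu hTu => ?_
    refine sub_eq_zero.1 (hsep _ ⟨fun n => u n - x, by simpa using hu.sub_const x, ?_⟩)
    simpa using hTu.sub_const (T x)
  intro s hs
  by_contra hs0
  have hstep : ∀ b : {b : U // b ∈ separatingSpace T ∧ b ≠ 0},
      ∃ (b' : {b : U // b ∈ separatingSpace T ∧ b ≠ 0}) (c : U) (M : Ideal U) (x : U),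
        M.IsMaximal ∧ ‖c‖ ≤ 1 ∧ b'.1 = c * b.1 ∧ b.1 * x ∉ M ∧ b'.1 * x ∈ M := by
    rintro ⟨b, hb, hb0⟩
    by_contra! h
    refine hb0 (eq_zero_of_unique_annihilator hss hT hb ?_)
    intro M M' hM hM' x x' hx hx' c hc
    by_contra hc'
    have ht : ((‖c‖ + 1 : ℝ) : ℂ)⁻¹ ≠ 0 :=
      inv_ne_zero (Complex.ofReal_ne_zero.2 (by positivity))
    have hcb : (((‖c‖ + 1 : ℝ) : ℂ)⁻¹ • c) * b ≠ 0 := by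
      rw [smul_mul_assoc]
      refine smul_ne_zero ht fun h0 => hc' ?_
      rw [← mul_assoc, h0, zero_mul]
      exact M'.zero_mem
    refine h ⟨_, mul_mem_separatingSpace_left hT hb _, hcb⟩ _ M x hM ?_ rfl hx ?_
    · rw [norm_smul, norm_inv, Complex.norm_real, Real.norm_of_nonneg (by positivity),
        inv_mul_le_iff₀ (by positivity)]
      linarith
    · change _ * b * x ∈ M
      rw [smul_mul_assoc, smul_mul_assoc, mul_assoc, ← smul_one_mul]
      exact M.mul_mem_left _ hc
  choose next c M x hM hc hnext hx hx' using hstep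
  let B : ℕ → {b : U // b ∈ separatingSpace T ∧ b ≠ 0} :=
    fun n => Nat.rec ⟨s, hs, hs0⟩ (fun _ b => next b) n
  have hclosed : ∀ n, IsClosed (M (B n) : Set U) := fun n => (hM (B n)).isClosed
  let φ : ∀ n, U →ₗ[ℂ] U ⧸ M (B n) := fun n =>
    ((M (B n)).mkQ.restrictScalars ℂ).comp ((LinearMap.mulRight ℂ (x (B n))).comp T)
  refine false_of_gliding_hump (fun n => (B n).1) (fun n => c (B n)) (fun n => hnext _)
    (fun n => hc _) φ (fun a => ‖T a‖) (fun n => ‖x (B n)‖) (fun n a => ?_)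
    (fun n => ‖T (B (n + 1)).1 * x (B n)‖) (fun n a => ?_) (fun n K => ?_)
  · calc ‖φ n a‖ ≤ ‖T a * x (B n)‖ := Submodule.Quotient.norm_mk_le _ _
      _ ≤ ‖T a‖ * ‖x (B n)‖ := norm_mul_le _ _
      _ = _ := mul_comm _ _
  · have h1 : φ n (a * (B (n + 1)).1) = (M (B n)).mkQ (a * (T (B (n + 1)).1 * x (B n))) := by
      change (M (B n)).mkQ (T (a * (B (n + 1)).1) * x (B n)) = _
      rw [← sub_eq_zero, ← map_sub, Submodule.mkQ_apply, Submodule.Quotient.mk_eq_zero, hT]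
      have : (a * T (B (n + 1)).1 + T a * (B (n + 1)).1) * x (B n)
          - a * (T (B (n + 1)).1 * x (B n)) = T a * ((B (n + 1)).1 * x (B n)) := by
        noncomm_ring
      rw [this]
      exact Ideal.mul_mem_left _ _ (hx' (B n))
    rw [h1]
    refine (Submodule.Quotient.norm_mk_le _ _).trans ((norm_mul_le _ _).trans_eq (mul_comm _ _))
  · obtain ⟨a, ha⟩ := exists_mul_sub_one_mem (hM (B n)) (hx (B n))
    refine not_bounded_of_mem_separatingSpace hT (hM (B n)) (b := (B n).1) (x := x (B n))
      (mul_mem_separatingSpace_right hT (B n).2.1 (x (B n) * a)) (fun hmem => hx (B n) ?_) K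
    have h2 := (M (B n)).mul_mem_left ((B n).1 * x (B n)) ha
    have h3 := (M (B n)).sub_mem hmem h2
    convert h3 using 1
    noncomm_ring

end Derivation

/-- If U is a semisimple Banach algebra (its Jacobson radical is zero:
any u with 1 - v*u invertible for every v must vanish), then every derivation
D : A ×_θ U → U (U regarded as a Banach (A ×_θ U)-bimodule via the ideal structure)
is automatically continuous. -/
theorem lau_derivation_into_semisimple_U_continuous {A U : Type*}
    [NonUnitalNormedRing A] [NormedSpace ℂ A] [IsScalarTower ℂ A A]
    [SMulCommClass ℂ A A] [CompleteSpace A]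
    [NormedRing U] [NormedAlgebra ℂ U] [CompleteSpace U]
    (hss : ∀ u : U, (∀ v : U, IsUnit (1 - v * u)) → u = 0)
    (θ : A →L[ℂ] ℂ) (hθmul : ∀ a b : A, θ (a * b) = θ a * θ b) (hθ0 : θ ≠ 0)
    (D : (A × U) →ₗ[ℂ] U)
    (hD : ∀ p q : A × U, D (lauMul (fun a => θ a) p q) =
      (θ p.1 • D q + p.2 * D q) + (θ q.1 • D p + D p * q.2)) :
    Continuous D := by
  have hA : ∀ a : A, D (a, 0) = 0 := fun a => by
    have h := hD (a, 0) (0, 1)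
    have h1 : ((0 : A), θ a • (1 : U)) = θ a • (0, 1) := by simp
    simp only [lauMul, mul_zero, smul_zero, add_zero, zero_mul, map_zero, zero_smul, zero_add,
      mul_one, h1, map_smul] at h
    simpa using h
  have hT : ∀ u v, (D.comp (LinearMap.inr ℂ A U)) (u * v) =
      u * (D.comp (LinearMap.inr ℂ A U)) v + (D.comp (LinearMap.inr ℂ A U)) u * v := fun u v => by
    simpa [lauMul] using hD (0, u) (0, v)
  have hD_eq : ∀ p, D p = (D.comp (LinearMap.inr ℂ A U)) p.2 := fun p => by
    have : p = (p.1, 0) + (0, p.2) := by simp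
    rw [this, map_add, hA]
    simp
  rw [funext hD_eq]
  exact (continuous_of_derivation_of_semisimple hss hT).comp continuous_snd
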